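/- arXiv:2202.12111 — 5 statements merged into one kernel-verified Lean document; each statement's English description precedes it below -/
import Mathlib

section
/- Let q be an odd prime and let C be a linear [n,k]_q code with parity check matrix H (an (n−k)×n matrix over ZMod q whose rows are linearly independent), where C = {x ∈ (ZMod q)^n : H·xᵀ = 0}. Let Ĥ be the matrix whose columns are all nonzero scalar multiples of columns of H, let h : (ZMod q)^{n−k} → ℂ be the indicator function of the set of columns of Ĥ, and let ĥ be the Vilenkin–Chrestenson transform of h. Then the covering radius ρ(C) equals the smallest natural number j such that the Vilenkin–Chrestenson transform of ĥ^j (the pointwise j-th power of ĥ) is nonzero at every y ∈ (ZMod q)^{n−k} with y ≠ 0. -/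
open Classical

/-- The Vilenkin–Chrestenson transform of a function `h : (ZMod q)^s → ℂ` with respect to a
complex number `ξ` (intended: a primitive `q`-th root of unity):
`ĥ(ω) = Σ_x h(x) ξ^{ω·x}`, the exponent being the integer representative of `ω·x ∈ ZMod q`. -/
noncomputable def vcTransform (q s : ℕ) [NeZero q] (ξ : ℂ)
    (h : (Fin s → ZMod q) → ℂ) : (Fin s → ZMod q) → ℂ :=
  fun ω => ∑ x : Fin s → ZMod q, h x * ξ ^ (∑ i, ω i * x i).val

/-- The covering radius of a code `C` (a set of words of length `n` over `F`): the smallest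
`s` such that every word is within Hamming distance `s` of some codeword. -/
noncomputable def coveringRadius {n : ℕ} {F : Type*} [DecidableEq F]
    (C : Set (Fin n → F)) : ℕ :=
  sInf {s : ℕ | ∀ v : Fin n → F, ∃ c ∈ C, hammingDist v c ≤ s}

/-- The characteristic (indicator) function of the columns of
`Ĥ = (H | α₂H | … | α_{q-1}H)`, i.e. of the set of all nonzero scalar multiples of columns
of the parity check matrix `H`. -/
noncomputable def colIndicator {r n : ℕ} {F : Type*} [CommRing F]
    (H : Matrix (Fin r) (Fin n) F) : (Fin r → F) → ℂ :=
  fun y => if ∃ u : F, u ≠ 0 ∧ ∃ j : Fin n, y = u • (fun i => H i j) then 1 else 0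

/-- The nonzero scalar multiples of the columns of `H`. -/
def scaledColumns {r n : ℕ} {F : Type*} [CommRing F] (H : Matrix (Fin r) (Fin n) F) :
    Set (Fin r → F) :=
  {y | ∃ u : F, u ≠ 0 ∧ ∃ j : Fin n, y = u • (fun i => H i j)}

/-- `y` is a sum of exactly `j` elements of `S`, repetitions allowed. -/
def IsSumOfExactly {V : Type*} [AddCommMonoid V] (S : Set V) (j : ℕ) (y : V) : Prop :=
  ∃ f : Fin j → V, (∀ i, f i ∈ S) ∧ ∑ i, f i = y

section Transform

variable {q s : ℕ} {ξ : ℂ}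

/-- Orthogonality of the characters of `(ZMod q)^s`. -/
theorem sum_zmodChar_dotProduct [NeZero q] (hξ : IsPrimitiveRoot ξ q) (z : Fin s → ZMod q) :
    ∑ ω : Fin s → ZMod q, AddChar.zmodChar q hξ.pow_eq_one (ω ⬝ᵥ z) =
      if z = 0 then (q : ℂ) ^ s else 0 := by
  let ψ : AddChar (Fin s → ZMod q) ℂ :=
    { toFun := fun ω => AddChar.zmodChar q hξ.pow_eq_one (ω ⬝ᵥ z)
      map_zero_eq_one' := by simp
      map_add_eq_mul' := fun a b => by rw [add_dotProduct, AddChar.map_add_eq_mul] }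
  have hψ : ψ = 0 ↔ z = 0 := by
    constructor
    · intro h
      have hprim := AddChar.zmodChar_primitive_of_primitive_root q hξ
      by_contra hz
      obtain ⟨i, hi⟩ := Function.ne_iff.mp hz
      refine hprim hi (DFunLike.ext _ _ fun a => ?_)
      have := DFunLike.congr_fun h (Pi.single i a)
      simpa [ψ, AddChar.mulShift_apply, mul_comm] using this
    · rintro rfl
      ext ω
      simp [ψ]
  have h := AddChar.sum_eq_ite ψ
  simp only [hψ] at h
  simpa [ψ] using h

theorem vcTransform_eq_sum_zmodChar [NeZero q] (hξ : IsPrimitiveRoot ξ q)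
    (h : (Fin s → ZMod q) → ℂ) (ω : Fin s → ZMod q) :
    vcTransform q s ξ h ω =
      ∑ x, h x * AddChar.zmodChar q hξ.pow_eq_one (ω ⬝ᵥ x) := by
  simp [vcTransform, AddChar.zmodChar_apply, dotProduct]

/-- The transform turns powers into iterated convolutions. -/
theorem vcTransform_pow_vcTransform [NeZero q] (hξ : IsPrimitiveRoot ξ q)
    (h : (Fin s → ZMod q) → ℂ) (j : ℕ) (y : Fin s → ZMod q) :
    vcTransform q s ξ (vcTransform q s ξ h ^ j) y =
      ∑ f : Fin j → Fin s → ZMod q,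
        (∏ i, h (f i)) * if ∑ i, f i + y = 0 then (q : ℂ) ^ s else 0 := by
  have hpow (ω : Fin s → ZMod q) : (vcTransform q s ξ h ^ j) ω =
      ∑ f : Fin j → Fin s → ZMod q,
        (∏ i, h (f i)) * AddChar.zmodChar q hξ.pow_eq_one (ω ⬝ᵥ ∑ i, f i) := by
    rw [Pi.pow_apply, vcTransform_eq_sum_zmodChar hξ, Fintype.sum_pow]
    refine Finset.sum_congr rfl fun f _ => ?_
    rw [Finset.prod_mul_distrib, dotProduct_sum]
    congr 1
    exact (map_prod (AddChar.zmodChar q hξ.pow_eq_one).toMonoidHom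
      (fun i => Multiplicative.ofAdd (ω ⬝ᵥ f i)) Finset.univ).symm
  rw [vcTransform_eq_sum_zmodChar hξ]
  simp_rw [hpow, Finset.sum_mul]
  rw [Finset.sum_comm]
  refine Finset.sum_congr rfl fun f _ => ?_
  rw [← sum_zmodChar_dotProduct hξ, Finset.mul_sum]
  refine Finset.sum_congr rfl fun ω _ => ?_
  rw [dotProduct_add, AddChar.map_add_eq_mul, dotProduct_comm y ω, mul_assoc]

theorem vcTransform_pow_vcTransform_colIndicator_ne_zero_iff [NeZero q]
    (hξ : IsPrimitiveRoot ξ q) {n : ℕ} (H : Matrix (Fin s) (Fin n) (ZMod q)) (j : ℕ)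
    (y : Fin s → ZMod q) :
    vcTransform q s ξ (vcTransform q s ξ (colIndicator H) ^ j) y ≠ 0 ↔
      IsSumOfExactly (scaledColumns H) j (-y) := by
  have hterm (f : Fin j → Fin s → ZMod q) :
      ((∏ i, colIndicator H (f i)) * if ∑ i, f i + y = 0 then (q : ℂ) ^ s else 0) =
        (((if (∀ i, f i ∈ scaledColumns H) ∧ ∑ i, f i = -y then q ^ s else 0 : ℕ)) : ℂ) := by
    have hprod : ∏ i, colIndicator H (f i) =
        if ∀ i, f i ∈ scaledColumns H then (1 : ℂ) else 0 := by
      have hind (i : Fin j) :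
          colIndicator H (f i) = if f i ∈ scaledColumns H then (1 : ℂ) else 0 := by
        unfold colIndicator
        congr
      simp_rw [hind, Finset.prod_ite_zero, Finset.prod_const_one, Finset.mem_univ, true_imp_iff]
    simp only [hprod, ← add_eq_zero_iff_eq_neg]
    split_ifs <;> simp_all
  rw [vcTransform_pow_vcTransform hξ]
  simp_rw [hterm]
  rw [← Nat.cast_sum, Nat.cast_ne_zero, Ne, Finset.sum_eq_zero_iff]
  simp [IsSumOfExactly, NeZero.ne q]

end Transform

section Code

variable {F : Type*} [Field F] {r n : ℕ}

theorem IsSumOfExactly.succ_of_scaledColumns {H : Matrix (Fin r) (Fin n) F} (h2 : (2 : F) ≠ 0)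
    {t : ℕ} {y : Fin r → F} (h : IsSumOfExactly (scaledColumns H) (t + 1) y) :
    IsSumOfExactly (scaledColumns H) (t + 2) y := by
  obtain ⟨f, hf, rfl⟩ := h
  obtain ⟨u, hu, c, hc⟩ := hf 0
  refine ⟨Fin.cons ((2 : F) • f 0) (Fin.cons (-f 0) (Fin.tail f)), fun i => ?_, ?_⟩
  · refine Fin.cases ?_ (fun i => Fin.cases ?_ (fun i => ?_) i) i
    · exact ⟨2 * u, mul_ne_zero h2 hu, c, by simp [hc, mul_smul]⟩
    · exact ⟨-u, neg_ne_zero.mpr hu, c, by simp [hc]⟩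
    · simpa [Fin.tail] using hf i.succ
  · simp only [Fin.sum_univ_succ, Fin.cons_zero, Fin.cons_succ, Fin.tail, two_smul]
    abel

theorem IsSumOfExactly.mono_of_scaledColumns {H : Matrix (Fin r) (Fin n) F} (h2 : (2 : F) ≠ 0)
    {t j : ℕ} (htj : t ≤ j) {y : Fin r → F} (hy : y ≠ 0)
    (h : IsSumOfExactly (scaledColumns H) t y) : IsSumOfExactly (scaledColumns H) j y := by
  induction j, htj using Nat.le_induction with
  | base => exact h
  | succ j _ ih =>
    cases j with
    | zero =>
      obtain ⟨f, -, hf⟩ := ih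
      exact absurd (by simpa using hf.symm) hy
    | succ j => exact ih.succ_of_scaledColumns h2

theorem Matrix.mulVec_surjective_of_linearIndependent_rows {H : Matrix (Fin r) (Fin n) F}
    (hH : LinearIndependent F (fun i => H i)) : Function.Surjective H.mulVec := by
  have hrank : H.rank = r := by simpa using LinearIndependent.rank_matrix hH
  have htop : LinearMap.range H.mulVecLin = ⊤ :=
    Submodule.eq_top_of_finrank_eq (by simpa [Matrix.rank] using hrank)
  exact LinearMap.range_eq_top.mp htop

variable [DecidableEq F]

theorem isSumOfExactly_hammingNorm_mulVec (H : Matrix (Fin r) (Fin n) F) (x : Fin n → F) :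
    IsSumOfExactly (scaledColumns H) (hammingNorm x) (H.mulVec x) := by
  let T : Finset (Fin n) := {i | x i ≠ 0}
  let e : T ≃ Fin (hammingNorm x) := T.equivFin
  refine ⟨fun i => x (e.symm i) • fun l => H l (e.symm i), fun i => ?_, ?_⟩
  · exact ⟨_, (Finset.mem_filter.mp (e.symm i).2).2, _, rfl⟩
  · rw [e.symm.sum_comp (fun i : T => x i • fun l => H l i),
      Finset.sum_coe_sort T (fun i => x i • fun l => H l i)]
    ext l
    simp only [Finset.sum_apply, Pi.smul_apply, smul_eq_mul, Matrix.mulVec, dotProduct]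
    refine Finset.sum_subset_zero_on_sdiff (Finset.subset_univ T) (fun i hi => ?_)
      fun i _ => mul_comm _ _
    have : x i = 0 := by simpa [T] using hi
    simp [this]

theorem IsSumOfExactly.exists_mulVec_eq {H : Matrix (Fin r) (Fin n) F} {j : ℕ} {y : Fin r → F}
    (h : IsSumOfExactly (scaledColumns H) j y) :
    ∃ x, H.mulVec x = y ∧ hammingNorm x ≤ j := by
  obtain ⟨f, hf, rfl⟩ := h
  choose u _ c hc using hf
  refine ⟨∑ i, Pi.single (c i) (u i), ?_, ?_⟩
  · rw [Matrix.mulVec_sum]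
    refine Finset.sum_congr rfl fun i _ => ?_
    rw [hc i]
    ext l
    simp [mul_comm]
  · have hsub : ({l | (∑ i, Pi.single (c i) (u i) : Fin n → F) l ≠ 0} : Finset (Fin n)) ⊆
        Finset.univ.image c := by
      intro l hl
      by_contra hlc
      refine (Finset.mem_filter.mp hl).2 ?_
      rw [Finset.sum_apply]
      refine Finset.sum_eq_zero fun i _ => Pi.single_eq_of_ne ?_ _
      rintro rfl
      exact hlc (Finset.mem_image_of_mem c (Finset.mem_univ i))
    simpa [hammingNorm] using (Finset.card_le_card hsub).trans Finset.card_image_le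

/-- A radius covers iff every syndrome is attained by a word of at most that weight. -/
theorem forall_hammingDist_le_iff {H : Matrix (Fin r) (Fin n) F}
    (hsurj : Function.Surjective H.mulVec) (t : ℕ) :
    (∀ v, ∃ c ∈ {x | H.mulVec x = 0}, hammingDist v c ≤ t) ↔
      ∀ y, ∃ x, H.mulVec x = y ∧ hammingNorm x ≤ t := by
  constructor
  · intro h y
    obtain ⟨v, rfl⟩ := hsurj y
    obtain ⟨c, hc, hd⟩ := h v
    refine ⟨-c + v, ?_, ?_⟩
    · simp [Matrix.mulVec_add, Matrix.mulVec_neg, Set.mem_ofPred_eq.mp hc]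
    · rwa [← hammingDist_eq_hammingNorm, hammingDist_comm]
  · intro h v
    obtain ⟨x, hx, hn⟩ := h (H.mulVec v)
    refine ⟨v - x, by simp [Matrix.mulVec_sub, hx], ?_⟩
    rw [hammingDist_comm, hammingDist_eq_hammingNorm]
    simpa using hn

theorem coveringRadius_isLeast {H : Matrix (Fin r) (Fin n) F}
    (hsurj : Function.Surjective H.mulVec) :
    IsLeast {t | ∀ y, ∃ x, H.mulVec x = y ∧ hammingNorm x ≤ t}
      (coveringRadius {x | H.mulVec x = 0}) := by
  have hne : {t | ∀ y, ∃ x, H.mulVec x = y ∧ hammingNorm x ≤ t}.Nonempty :=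
    ⟨n, fun y => (hsurj y).imp fun x hx =>
      ⟨hx, by simpa using hammingNorm_le_card_fintype (x := x)⟩⟩
  simp only [coveringRadius, forall_hammingDist_le_iff hsurj]
  exact ⟨Nat.sInf_mem hne, fun t ht => Nat.sInf_le ht⟩

end Code

/-- for an odd prime `q` and a linear `[n,k]_q` code `C` with parity check
matrix `H`, the covering radius of `C` is the least natural number `j` such that the
Vilenkin–Chrestenson transform of `ĥ^j` is nonzero at every nonzero `y`, where
`ĥ` is the Vilenkin–Chrestenson transform of the indicator function of the columns of `Ĥ`. -/
theorem coveringRadius_eq_least_vcTransform_pow_ne_zero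
    (q : ℕ) [Fact q.Prime] (hodd : Odd q) (ξ : ℂ) (hξ : IsPrimitiveRoot ξ q)
    (n k : ℕ) (hkn : k ≤ n)
    (H : Matrix (Fin (n - k)) (Fin n) (ZMod q))
    (hH : LinearIndependent (ZMod q) (fun i => H i)) :
    IsLeast {j : ℕ | ∀ y : Fin (n - k) → ZMod q, y ≠ 0 →
        vcTransform q (n - k) ξ ((vcTransform q (n - k) ξ (colIndicator H)) ^ j) y ≠ 0}
      (coveringRadius {x : Fin n → ZMod q | H.mulVec x = 0}) := by
  have h2 : (2 : ZMod q) ≠ 0 := by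
    refine Ring.two_ne_zero ?_
    rw [ZMod.ringChar_zmod_n]
    rintro rfl
    exact absurd hodd (by decide)
  obtain ⟨hmem, hle⟩ := coveringRadius_isLeast
    (Matrix.mulVec_surjective_of_linearIndependent_rows hH)
  simp only [vcTransform_pow_vcTransform_colIndicator_ne_zero_iff hξ]
  constructor
  · intro y hy
    obtain ⟨x, hx, hn⟩ := hmem (-y)
    have h := isSumOfExactly_hammingNorm_mulVec H x
    rw [hx] at h
    exact h.mono_of_scaledColumns h2 hn (neg_ne_zero.mpr hy)
  · intro j hj
    refine hle fun y => ?_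
    by_cases hy : y = 0
    · exact ⟨0, by simp [hy], by simp⟩
    · simpa using (hj (-y) (neg_ne_zero.mpr hy)).exists_mulVec_eq
end

section
/- Let q be an odd prime and h : (ZMod q)^s → ℤ a function satisfying h(u•x) = h(x) for all nonzero u ∈ ZMod q and all x ∈ (ZMod q)^s. If ĥ : (ZMod q)^s → ℂ is the Vilenkin–Chrestenson transform of h, then ĥ takes only integer values (i.e., ĥ(ω) ∈ ℤ for all ω), and ĥ(u•ω) = ĥ(ω) for all nonzero u ∈ ZMod q and all ω ∈ (ZMod q)^s. -/
/-- Summing over a space on which `u ≠ 0` acts is invariant under the substitution `x ↦ u • x`. -/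
lemma sum_smul_eq_sum {K V M : Type*} [Field K] [AddCommGroup V] [Module K V] [Fintype V]
    [AddCommMonoid M] {u : K} (hu : u ≠ 0) (f : V → M) : ∑ x, f (u • x) = ∑ x, f x :=
  Equiv.sum_comp (MulAction.toPerm (Units.mk0 u hu)) f

/-- The powers of a primitive `q`-th root of unity, indexed by `ZMod q`, sum to zero. -/
lemma IsPrimitiveRoot.sum_pow_zmod_val_eq_zero {R : Type*} [CommRing R] [IsDomain R] {q : ℕ}
    [NeZero q] {ξ : R} (hξ : IsPrimitiveRoot ξ q) (hq : 1 < q) :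
    ∑ t : ZMod q, ξ ^ t.val = 0 := by
  rw [← hξ.geom_sum_eq_zero hq]
  exact Finset.sum_bij' (fun t _ => t.val) (fun n _ => (n : ZMod q))
    (fun t _ => Finset.mem_range.2 t.val_lt) (fun _ _ => Finset.mem_univ _)
    (fun t _ => ZMod.natCast_zmod_val t)
    (fun n hn => ZMod.val_cast_of_lt (Finset.mem_range.1 hn)) (fun _ _ => rfl)

/-- The Vilenkin–Chrestenson transform, with the terms grouped by the value of `ω·x`. -/
lemma vcTransform_intCast_eq_sum_fiber (q s : ℕ) [NeZero q] (ξ : ℂ) (h : (Fin s → ZMod q) → ℤ)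
    (ω : Fin s → ZMod q) :
    vcTransform q s ξ (fun x => (h x : ℂ)) ω =
      ∑ t : ZMod q, ((∑ x, if ω ⬝ᵥ x = t then h x else 0 : ℤ) : ℂ) * ξ ^ t.val := by
  simp only [Int.cast_sum, Finset.sum_mul]
  rw [Finset.sum_comm]
  refine Finset.sum_congr rfl fun x _ => ?_
  rw [Finset.sum_eq_single (ω ⬝ᵥ x) (fun t _ ht => by rw [if_neg ht.symm, Int.cast_zero, zero_mul])
    (fun ht => absurd (Finset.mem_univ _) ht), if_pos rfl]
  rfl

/-- For an invariant function, the sums over the fibres of `x ↦ ω·x` above nonzero values agree. -/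
lemma sum_fiber_eq_sum_fiber_one {q s : ℕ} [Fact q.Prime] {h : (Fin s → ZMod q) → ℤ}
    (hinv : ∀ u : ZMod q, u ≠ 0 → ∀ x : Fin s → ZMod q, h (u • x) = h x)
    (ω : Fin s → ZMod q) {t : ZMod q} (ht : t ≠ 0) :
    (∑ x, if ω ⬝ᵥ x = t then h x else 0) = ∑ x, if ω ⬝ᵥ x = 1 then h x else 0 := by
  rw [← sum_smul_eq_sum ht]
  simp only [dotProduct_smul, smul_eq_mul, hinv t ht, mul_eq_left₀ ht]

/-- for an odd prime `q` and an integer-valued function `h : (ZMod q)^s → ℤ`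
with `h(u•x) = h(x)` for all nonzero scalars `u`, the Vilenkin–Chrestenson transform `ĥ`
takes only integer values and satisfies `ĥ(u•ω) = ĥ(ω)` for all nonzero `u`. -/
theorem vcTransform_int_valued_of_invariant (q : ℕ) [Fact q.Prime] (hodd : Odd q)
    (s : ℕ) (ξ : ℂ) (hξ : IsPrimitiveRoot ξ q) (h : (Fin s → ZMod q) → ℤ)
    (hinv : ∀ u : ZMod q, u ≠ 0 → ∀ x : Fin s → ZMod q, h (u • x) = h x) :
    (∀ ω : Fin s → ZMod q, ∃ m : ℤ, vcTransform q s ξ (fun x => (h x : ℂ)) ω = (m : ℂ)) ∧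
      (∀ u : ZMod q, u ≠ 0 → ∀ ω : Fin s → ZMod q,
        vcTransform q s ξ (fun x => (h x : ℂ)) (u • ω) =
          vcTransform q s ξ (fun x => (h x : ℂ)) ω) := by
  refine ⟨fun ω => ?_, fun u hu ω => ?_⟩
  · refine ⟨(∑ x, if ω ⬝ᵥ x = 0 then h x else 0) - ∑ x, if ω ⬝ᵥ x = 1 then h x else 0, ?_⟩
    have hsum := hξ.sum_pow_zmod_val_eq_zero (Fact.out : q.Prime).one_lt
    rw [← Finset.add_sum_erase _ _ (Finset.mem_univ 0), ZMod.val_zero, pow_zero] at hsum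
    have hfib : ∀ t ∈ Finset.univ.erase (0 : ZMod q),
        ((∑ x, if ω ⬝ᵥ x = t then h x else 0 : ℤ) : ℂ) * ξ ^ t.val =
          ((∑ x, if ω ⬝ᵥ x = 1 then h x else 0 : ℤ) : ℂ) * ξ ^ t.val := fun t ht => by
      rw [sum_fiber_eq_sum_fiber_one hinv ω (Finset.ne_of_mem_erase ht)]
    rw [vcTransform_intCast_eq_sum_fiber, ← Finset.add_sum_erase _ _ (Finset.mem_univ 0),
      ZMod.val_zero, pow_zero, mul_one, Finset.sum_congr rfl hfib, ← Finset.mul_sum,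
      eq_neg_of_add_eq_zero_right hsum, Int.cast_sub]
    ring
  · unfold vcTransform
    rw [← sum_smul_eq_sum hu fun x => (h x : ℂ) * ξ ^ (∑ i, ω i * x i).val]
    simp only [hinv u hu, Pi.smul_apply, smul_eq_mul, mul_left_comm, mul_assoc]
end

section
/- Let q = 2^l, and let C be a linear [n,k]_q code with parity check matrix H (an (n−k)×n matrix over F_q with linearly independent rows), where C = {x ∈ F_q^n : H·xᵀ = 0}. Let Ĥ be the matrix whose columns are all nonzero scalar multiples of columns of H, let h : F_q^{n−k} → ℂ be the indicator function of the set of columns of Ĥ, and let ĥ be the Trace transform of h. For j = 1, …, n define g_j(ω) = Σ_{i=1}^{j} (ĥ(ω))^i. Then the covering radius ρ(C) equals the smallest natural number j such that the Trace transform of g_j is nonzero at every y ∈ F_q^{n−k} with y ≠ 0. -/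
open Classical

/-- The Trace transform of a function `h : F^s → ℂ`, where `F` is a finite field of
characteristic `p` and `ζ ∈ ℂ` (intended: a primitive `p`-th root of unity):
`ĥ(ω) = Σ_x h(x) ζ^{Tr(ω·x)}`, the exponent being the integer representative of the
trace of the dot product. -/
noncomputable def traceTransform (p : ℕ) (F : Type*) [Field F] [Fintype F]
    [Algebra (ZMod p) F] (s : ℕ) (ζ : ℂ) (h : (Fin s → F) → ℂ) : (Fin s → F) → ℂ :=
  fun ω => ∑ x : Fin s → F, h x * ζ ^ (Algebra.trace (ZMod p) F (∑ i, ω i * x i)).val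

theorem addChar_sum_eq_prod {ι A M : Type*} [AddCommMonoid A] [CommMonoid M] (ψ : AddChar A M)
    (s : Finset ι) (f : ι → A) : ψ (∑ i ∈ s, f i) = ∏ i ∈ s, ψ (f i) := by
  induction s using Finset.cons_induction with
  | empty => simp
  | cons a s ha ih => rw [Finset.sum_cons, Finset.prod_cons, AddChar.map_add_eq_mul, ih]

/-- The additive character `a ↦ ζ ^ Tr(a)` of a finite field of characteristic `p`. -/
noncomputable def traceAddChar (p : ℕ) [NeZero p] (F : Type*) [Field F] [Algebra (ZMod p) F]
    {ζ : ℂ} (hζ : ζ ^ p = 1) : AddChar F ℂ :=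
  (AddChar.zmodChar p hζ).compAddMonoidHom (Algebra.trace (ZMod p) F).toAddMonoidHom

theorem traceAddChar_apply (p : ℕ) [NeZero p] (F : Type*) [Field F] [Algebra (ZMod p) F]
    {ζ : ℂ} (hζ : ζ ^ p = 1) (a : F) :
    traceAddChar p F hζ a = ζ ^ (Algebra.trace (ZMod p) F a).val := rfl

theorem exists_traceAddChar_ne_one (p : ℕ) [Fact p.Prime] (F : Type*) [Field F] [Fintype F]
    [Algebra (ZMod p) F] {ζ : ℂ} (hζ : IsPrimitiveRoot ζ p) :
    ∃ a : F, traceAddChar p F hζ.pow_eq_one a ≠ 1 := by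
  have hp : p.Prime := Fact.out
  have : Fact (1 < p) := ⟨hp.one_lt⟩
  obtain ⟨a, ha⟩ := Algebra.trace_surjective (ZMod p) F 1
  refine ⟨a, ?_⟩
  rw [traceAddChar_apply, ha, ZMod.val_one, pow_one]
  exact hζ.ne_one hp.one_lt

/-- Orthogonality relation for the characters `ω ↦ ζ ^ Tr(ω · z)` of `F ^ s`. -/
theorem sum_traceAddChar_dotProduct (p : ℕ) [Fact p.Prime] (F : Type*) [Field F] [Fintype F]
    [Algebra (ZMod p) F] {ζ : ℂ} (hζ : IsPrimitiveRoot ζ p) {s : ℕ} (z : Fin s → F) :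
    ∑ ω : Fin s → F, traceAddChar p F hζ.pow_eq_one (ω ⬝ᵥ z) =
      if z = 0 then (Fintype.card (Fin s → F) : ℂ) else 0 := by
  let φ : (Fin s → F) →+ F :=
    { toFun := fun ω => ω ⬝ᵥ z
      map_zero' := zero_dotProduct z
      map_add' := fun a b => add_dotProduct a b z }
  have key : (traceAddChar p F hζ.pow_eq_one).compAddMonoidHom φ = 0 ↔ z = 0 := by
    constructor
    · intro h
      by_contra hz
      obtain ⟨i, hi⟩ := Function.ne_iff.mp hz
      obtain ⟨a, ha⟩ := exists_traceAddChar_ne_one p F hζ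
      apply ha
      have := DFunLike.congr_fun h (Pi.single i (a / z i))
      have hzi : z i ≠ 0 := hi
      simpa [φ, hzi] using this
    · rintro rfl
      ext ω
      simp [φ]
  have := AddChar.sum_eq_ite ((traceAddChar p F hζ.pow_eq_one).compAddMonoidHom φ)
  simp only [key] at this
  exact this

/-- The Trace transform of a sum of powers of the Trace transform of an indicator function
counts the representations of `-y` as a sum of members of the set. -/
theorem traceTransform_sum_pow (p : ℕ) [Fact p.Prime] (F : Type*) [Field F] [Fintype F]
    [Algebra (ZMod p) F] {ζ : ℂ} (hζ : IsPrimitiveRoot ζ p) {s : ℕ}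
    (P : (Fin s → F) → Prop) (I : Finset ℕ) (y : Fin s → F) :
    traceTransform p F s ζ
        (fun ω => ∑ i ∈ I, traceTransform p F s ζ (fun x => if P x then 1 else 0) ω ^ i) y =
      ((Fintype.card (Fin s → F) * ∑ i ∈ I, ∑ f : Fin i → Fin s → F,
        if (∀ t, P (f t)) ∧ ∑ t, f t + y = 0 then 1 else 0 : ℕ) : ℂ) := by
  set ψ := traceAddChar p F hζ.pow_eq_one with hψ
  have hT : ∀ (h : (Fin s → F) → ℂ) ω,
      traceTransform p F s ζ h ω = ∑ x, h x * ψ (ω ⬝ᵥ x) := fun h ω => rfl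
  simp only [hT, Fintype.sum_pow, Finset.prod_mul_distrib, ← addChar_sum_eq_prod,
    ← dotProduct_sum, Finset.sum_mul]
  rw [Finset.sum_comm]
  push_cast
  rw [Finset.mul_sum]
  refine Finset.sum_congr rfl fun i _ => ?_
  rw [Finset.sum_comm, Finset.mul_sum]
  refine Finset.sum_congr rfl fun f _ => ?_
  have hsum : ∑ ω : Fin s → F, (∏ t, if P (f t) then (1 : ℂ) else 0) * ψ (ω ⬝ᵥ ∑ t, f t) *
      ψ (y ⬝ᵥ ω) = (∏ t, if P (f t) then (1 : ℂ) else 0) *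
        ∑ ω : Fin s → F, ψ (ω ⬝ᵥ (∑ t, f t + y)) := by
    rw [Finset.mul_sum]
    refine Finset.sum_congr rfl fun ω _ => ?_
    rw [dotProduct_add, AddChar.map_add_eq_mul, dotProduct_comm y ω, mul_assoc]
  rw [hsum, hψ, sum_traceAddChar_dotProduct p F hζ, Finset.prod_boole]
  by_cases h1 : ∀ t, P (f t) <;> by_cases h2 : ∑ t, f t + y = 0 <;> simp [h1, h2]

theorem traceTransform_sum_pow_ne_zero_iff (p : ℕ) [Fact p.Prime] (F : Type*) [Field F]
    [Fintype F] [Algebra (ZMod p) F] {ζ : ℂ} (hζ : IsPrimitiveRoot ζ p) {s : ℕ}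
    (P : (Fin s → F) → Prop) (I : Finset ℕ) (y : Fin s → F) :
    traceTransform p F s ζ
        (fun ω => ∑ i ∈ I, traceTransform p F s ζ (fun x => if P x then 1 else 0) ω ^ i) y ≠ 0 ↔
      ∃ i ∈ I, ∃ f : Fin i → Fin s → F, (∀ t, P (f t)) ∧ ∑ t, f t + y = 0 := by
  rw [traceTransform_sum_pow p F hζ, Nat.cast_ne_zero, mul_ne_zero_iff,
    and_iff_right Fintype.card_ne_zero]
  simp [Finset.sum_eq_zero_iff]

/-- A nonzero vector is, up to sign, a sum of between `1` and `j` nonzero multiples of columns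
of `H` if and only if it is the syndrome of a word of weight at most `j`. -/
theorem exists_sum_smul_col_iff {F : Type*} [Field F] [DecidableEq F] {r n : ℕ}
    (H : Matrix (Fin r) (Fin n) F) (j : ℕ) {y : Fin r → F} (hy : y ≠ 0) :
    (∃ i ∈ Finset.Icc 1 j, ∃ f : Fin i → Fin r → F,
        (∀ t, ∃ u : F, u ≠ 0 ∧ ∃ m : Fin n, f t = u • (fun a => H a m)) ∧ ∑ t, f t + y = 0) ↔
      ∃ e : Fin n → F, hammingNorm e ≤ j ∧ H.mulVec e = y := by
  constructor
  · rintro ⟨i, hi, f, hf, hs⟩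
    choose u _ m hm using hf
    let e : Fin n → F := -∑ t, Pi.single (m t) (u t)
    refine ⟨e, ?_, ?_⟩
    · refine le_trans ?_ (Finset.mem_Icc.mp hi).2
      calc hammingNorm e ≤ (Finset.univ.image m).card := by
            refine Finset.card_le_card fun a ha => ?_
            by_contra hma
            simp only [Finset.mem_image, Finset.mem_univ, true_and, not_exists] at hma
            refine (Finset.mem_filter.mp ha).2 ?_
            simp only [e, Pi.neg_apply, Finset.sum_apply, neg_eq_zero]
            exact Finset.sum_eq_zero fun t _ => Pi.single_eq_of_ne' (hma t) _
        _ ≤ i := by simpa using Finset.card_image_le (s := Finset.univ) (f := m)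
    · simp only [e]
      rw [Matrix.mulVec_neg, Matrix.mulVec_sum, neg_eq_iff_add_eq_zero, ← hs]
      congr 1
      refine Finset.sum_congr rfl fun t _ => ?_
      rw [hm t]
      ext a
      simp [Matrix.mulVec_single, mul_comm]
  · rintro ⟨e, he, rfl⟩
    let S : Finset (Fin n) := {a | e a ≠ 0}
    have hS : S.Nonempty := by
      rw [Finset.nonempty_iff_ne_empty]
      intro h
      refine hy ?_
      have : e = 0 := by
        ext a
        by_contra ha
        exact Finset.notMem_empty a (h ▸ Finset.mem_filter.mpr ⟨Finset.mem_univ a, ha⟩)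
      rw [this, Matrix.mulVec_zero]
    refine ⟨S.card, Finset.mem_Icc.mpr ⟨hS.card_pos, he⟩,
      fun t => (-e (S.equivFin.symm t)) • fun a => H a (S.equivFin.symm t), fun t => ?_, ?_⟩
    · exact ⟨_, neg_ne_zero.mpr (Finset.mem_filter.mp (S.equivFin.symm t).2).2, _, rfl⟩
    · rw [Equiv.sum_comp S.equivFin.symm (fun b : S => (-e b) • fun a => H a b),
        Finset.sum_coe_sort S (fun b => (-e b) • fun a => H a b)]
      have : ∑ b ∈ S, (-e b) • (fun a => H a b) = ∑ b, (-e b) • (fun a => H a b) := by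
        refine Finset.sum_subset (Finset.subset_univ S) fun b _ hb => ?_
        have : e b = 0 := by simpa [S] using hb
        simp [this]
      rw [this]
      ext a
      simp [Matrix.mulVec, dotProduct, mul_comm, Finset.sum_neg_distrib]

/-- For a linear code whose syndrome map is onto, every word is within distance `j` of the code
if and only if every syndrome is attained by a word of weight at most `j`. -/
theorem forall_exists_hammingDist_le_iff {F : Type*} [Field F] [DecidableEq F] {r n : ℕ}
    {H : Matrix (Fin r) (Fin n) F} (hH : Function.Surjective H.mulVec) (j : ℕ) :
    (∀ v, ∃ c ∈ {x : Fin n → F | H.mulVec x = 0}, hammingDist v c ≤ j) ↔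
      ∀ y, ∃ e : Fin n → F, hammingNorm e ≤ j ∧ H.mulVec e = y := by
  constructor
  · intro h y
    obtain ⟨v, rfl⟩ := hH y
    obtain ⟨c, hc, hd⟩ := h v
    refine ⟨v - c, ?_, ?_⟩
    · rwa [hammingDist_comm, hammingDist_eq_hammingNorm, neg_add_eq_sub] at hd
    · rw [Matrix.mulVec_sub, Set.mem_ofPred_eq.mp hc, sub_zero]
  · intro h v
    obtain ⟨e, he, hev⟩ := h (H.mulVec v)
    refine ⟨v - e, ?_, ?_⟩
    · rw [Set.mem_ofPred_eq, Matrix.mulVec_sub, hev, sub_self]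
    · rwa [hammingDist_comm, hammingDist_eq_hammingNorm, neg_add_eq_sub, sub_sub_cancel]

theorem mulVec_surjective_of_linearIndependent_row {F m n : Type*} [Field F] [Fintype m]
    [Fintype n] {H : Matrix m n F} (hH : LinearIndependent F H.row) :
    Function.Surjective H.mulVec := by
  have h := hH.rank_matrix
  rw [Matrix.rank, ← Module.finrank_fintype_fun_eq_card F] at h
  exact LinearMap.range_eq_top.mp (Submodule.eq_top_of_finrank_eq h)

theorem coveringRadius_isLeast_s7 {F : Type*} [DecidableEq F] {n : ℕ} {C : Set (Fin n → F)}
    (hC : C.Nonempty) :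
    IsLeast {s : ℕ | ∀ v : Fin n → F, ∃ c ∈ C, hammingDist v c ≤ s} (coveringRadius C) := by
  obtain ⟨c, hc⟩ := hC
  exact ⟨Nat.sInf_mem ⟨n, fun v => ⟨c, hc, hammingDist_le_card_fintype.trans_eq (Fintype.card_fin n)⟩⟩,
    fun _ => Nat.sInf_le⟩

/-- for `q = 2^l` and a linear `[n,k]_q` code `C` with parity check matrix
`H`, setting `g_j(ω) = Σ_{i=1}^{j} (ĥ(ω))^i` where `ĥ` is the Trace transform of the
indicator function of the columns of `Ĥ`, the covering radius of `C` is the least natural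
number `j` such that the Trace transform of `g_j` is nonzero at every nonzero
`y ∈ F^{n-k}`. -/
theorem coveringRadius_eq_least_traceTransform_powSum_ne_zero
    (l : ℕ) (hl : 1 ≤ l)
    (F : Type*) [Field F] [Fintype F] [DecidableEq F] [Algebra (ZMod 2) F]
    (hF : Fintype.card F = 2 ^ l)
    (ζ : ℂ) (hζ : IsPrimitiveRoot ζ 2)
    (n k : ℕ) (hkn : k ≤ n)
    (H : Matrix (Fin (n - k)) (Fin n) F)
    (hH : LinearIndependent F (fun i => H i)) :
    IsLeast {j : ℕ | ∀ y : Fin (n - k) → F, y ≠ 0 →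
        traceTransform 2 F (n - k) ζ
          (fun ω => ∑ i ∈ Finset.Icc 1 j,
            (traceTransform 2 F (n - k) ζ (colIndicator H) ω) ^ i) y ≠ 0}
      (coveringRadius {x : Fin n → F | H.mulVec x = 0}) := by
  have hsurj := mulVec_surjective_of_linearIndependent_row hH
  have hbase := coveringRadius_isLeast_s7 (C := {x : Fin n → F | H.mulVec x = 0})
    ⟨0, H.mulVec_zero⟩
  convert hbase using 1
  ext j
  rw [Set.mem_ofPred_eq, Set.mem_ofPred_eq, forall_exists_hammingDist_le_iff hsurj]
  refine forall_congr' fun y => ?_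
  by_cases hy : y = 0
  · subst hy
    exact iff_of_true (fun h => absurd rfl h) ⟨0, by simp, H.mulVec_zero⟩
  · rw [← exists_sum_smul_col_iff H j hy, forall_prop_of_true hy]
    exact traceTransform_sum_pow_ne_zero_iff 2 F hζ _ _ y
end

section
/- Let q = p^l with p prime, and let h : F_q^s → ℤ be a function satisfying h(u•x) = h(x) for all nonzero u ∈ F_q and all x ∈ F_q^s. If ĥ : F_q^s → ℂ is the Trace transform of h, then ĥ takes only integer values (i.e., ĥ(ω) ∈ ℤ for all ω), and ĥ(u•ω) = ĥ(ω) for all nonzero u ∈ F_q and all ω ∈ F_q^s. -/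
/-- A sum over a finite vector space is unchanged when its variable is scaled by `u ≠ 0`. -/
lemma sum_comp_smul_of_ne_zero {F V M : Type*} [Field F] [AddCommGroup V] [Module F V] [Fintype V]
    [AddCommMonoid M] {u : F} (hu : u ≠ 0) (f : V → M) : ∑ x, f (u • x) = ∑ x, f x :=
  Equiv.sum_comp (MulAction.toPerm (Units.mk0 u hu)) f

/-- The sum of all nontrivial powers of a primitive `p`-th root of unity is `-1`. -/
lemma IsPrimitiveRoot.sum_erase_zero_pow_val {p : ℕ} [Fact p.Prime] {R : Type*} [CommRing R]
    [IsDomain R] {ζ : R} (hζ : IsPrimitiveRoot ζ p) :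
    ∑ a ∈ Finset.univ.erase (0 : ZMod p), ζ ^ a.val = -1 := by
  have hψ := AddChar.sum_eq_zero_of_ne_one
    (AddChar.zmodChar_primitive_of_primitive_root p hζ one_ne_zero)
  simp only [AddChar.mulShift_one, AddChar.zmodChar_apply] at hψ
  rw [← Finset.add_sum_erase _ _ (Finset.mem_univ 0), ZMod.val_zero, pow_zero] at hψ
  exact eq_neg_of_add_eq_zero_right hψ

/-- If `c : ZMod p → ℤ` is constant off zero, then `∑ c a ζ^a` is the integer
`c 0 - c 1`. -/
lemma IsPrimitiveRoot.sum_mul_pow_val_of_const {p : ℕ} [Fact p.Prime] {R : Type*} [CommRing R]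
    [IsDomain R] {ζ : R} (hζ : IsPrimitiveRoot ζ p) (c : ZMod p → ℤ)
    (hc : ∀ a, a ≠ 0 → c a = c 1) :
    ∑ a, (c a : R) * ζ ^ a.val = ((c 0 - c 1 : ℤ) : R) := by
  rw [← Finset.add_sum_erase _ _ (Finset.mem_univ 0), Finset.sum_congr rfl
    (g := fun a : ZMod p => (c 1 : R) * ζ ^ a.val)
    (fun a ha => by rw [hc a (Finset.ne_of_mem_erase ha)]),
    ← Finset.mul_sum, hζ.sum_erase_zero_pow_val, ZMod.val_zero]
  push_cast
  ring

/-- let `q = p^l` with `p` prime and `h : F_q^s → ℤ` satisfy `h(u•x) = h(x)`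
for all nonzero `u ∈ F_q`. Then the Trace transform `ĥ` of `h` takes only integer values
and satisfies `ĥ(u•ω) = ĥ(ω)` for all nonzero `u ∈ F_q`. -/
theorem traceTransform_int_valued_of_invariant
    (p l : ℕ) [Fact p.Prime] (hl : 1 ≤ l)
    (F : Type*) [Field F] [Fintype F] [Algebra (ZMod p) F]
    (hF : Fintype.card F = p ^ l)
    (ζ : ℂ) (hζ : IsPrimitiveRoot ζ p) (s : ℕ) (h : (Fin s → F) → ℤ)
    (hinv : ∀ u : F, u ≠ 0 → ∀ x : Fin s → F, h (u • x) = h x) :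
    (∀ ω : Fin s → F, ∃ m : ℤ,
        traceTransform p F s ζ (fun x => (h x : ℂ)) ω = (m : ℂ)) ∧
      (∀ u : F, u ≠ 0 → ∀ ω : Fin s → F,
        traceTransform p F s ζ (fun x => (h x : ℂ)) (u • ω) =
          traceTransform p F s ζ (fun x => (h x : ℂ)) ω) := by
  refine ⟨fun ω => ?_, fun u hu ω => ?_⟩
  · set T : (Fin s → F) → ZMod p := fun x => Algebra.trace (ZMod p) F (∑ i, ω i * x i) with hT
    have hTs (a : ZMod p) (x : Fin s → F) : T (algebraMap (ZMod p) F a • x) = a * T x := by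
      simp only [hT, Pi.smul_apply, smul_eq_mul, mul_left_comm (ω _), ← Finset.mul_sum]
      rw [← Algebra.smul_def, map_smul, smul_eq_mul]
    set c : ZMod p → ℤ := fun a => ∑ x, if T x = a then h x else 0 with hc
    have hconst (a : ZMod p) (ha : a ≠ 0) : c a = c 1 := by
      have hu : algebraMap (ZMod p) F a ≠ 0 := by simpa using ha
      simp only [hc]
      rw [← sum_comp_smul_of_ne_zero hu]
      refine Finset.sum_congr rfl fun x _ => ?_
      simp only [hTs, hinv _ hu, mul_eq_left₀ ha]
    refine ⟨c 0 - c 1, ?_⟩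
    rw [← hζ.sum_mul_pow_val_of_const c hconst]
    simp only [hc, Int.cast_sum, Finset.sum_mul]
    rw [Finset.sum_comm]
    refine Finset.sum_congr rfl fun x _ => ?_
    simp [ite_mul, hT]
  · unfold traceTransform
    rw [← sum_comp_smul_of_ne_zero hu
      (fun x => (h x : ℂ) * ζ ^ (Algebra.trace (ZMod p) F (∑ i, ω i * x i)).val)]
    refine Finset.sum_congr rfl fun x _ => ?_
    simp only [hinv u hu, Pi.smul_apply, smul_eq_mul, mul_left_comm (ω _), mul_assoc]
end

section
/- Let q be an odd prime and let C be a linear [n,k]_q code with parity check matrix H. Let Ĥ be the matrix whose columns are all nonzero scalar multiples of columns of H, h = h_H the indicator function of the columns of Ĥ, and ĥ its Vilenkin–Chrestenson transform. Then for every natural number j ≥ 1 and every nonzero y ∈ (ZMod q)^{n−k}, the Vilenkin–Chrestenson transform of ĥ^j evaluated at y is nonzero if and only if y is a linear combination of at most j columns of H. -/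
open Classical

open scoped Pointwise in
theorem mem_nsmul_iff_exists_fin_sum {V : Type*} [AddCommMonoid V] (S : Set V) (j : ℕ) (y : V) :
    y ∈ j • S ↔ ∃ p : Fin j → V, (∀ i, p i ∈ S) ∧ ∑ i, p i = y := by
  rw [Set.mem_nsmul]
  constructor
  · rintro ⟨f, rfl⟩
    exact ⟨fun i => f i, fun i => (f i).2, by rw [List.sum_ofFn]⟩
  · rintro ⟨p, hp, rfl⟩
    exact ⟨fun i => ⟨p i, hp i⟩, by rw [List.sum_ofFn]⟩

/-- The set of nonzero scalar multiples of columns of `H`. -/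
def columnMultiples {r n : ℕ} {F : Type*} [CommRing F] (H : Matrix (Fin r) (Fin n) F) :
    Set (Fin r → F) :=
  {y | ∃ u : F, u ≠ 0 ∧ ∃ j : Fin n, y = u • (fun i => H i j)}

theorem neg_mem_columnMultiples {r n : ℕ} {F : Type*} [CommRing F]
    {H : Matrix (Fin r) (Fin n) F} {x : Fin r → F} (hx : x ∈ columnMultiples H) :
    -x ∈ columnMultiples H := by
  obtain ⟨u, hu, c, rfl⟩ := hx
  exact ⟨-u, neg_ne_zero.2 hu, c, by rw [neg_smul]⟩

open scoped Pointwise in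
theorem neg_mem_nsmul_columnMultiples {r n : ℕ} {F : Type*} [CommRing F]
    {H : Matrix (Fin r) (Fin n) F} {j : ℕ} {x : Fin r → F} (hx : x ∈ j • columnMultiples H) :
    -x ∈ j • columnMultiples H := by
  rw [mem_nsmul_iff_exists_fin_sum] at hx ⊢
  obtain ⟨p, hp, rfl⟩ := hx
  exact ⟨fun i => -p i, fun i => neg_mem_columnMultiples (hp i), by rw [Finset.sum_neg_distrib]⟩

open scoped Pointwise in
theorem columnMultiples_subset_add_self {r n : ℕ} {F : Type*} [Field F] (h2 : (2 : F) ≠ 0)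
    (H : Matrix (Fin r) (Fin n) F) :
    columnMultiples H ⊆ columnMultiples H + columnMultiples H := by
  rintro _ ⟨u, hu, c, rfl⟩
  refine Set.mem_add.2 ⟨_, ⟨2 * u, mul_ne_zero h2 hu, c, rfl⟩, _,
    ⟨-u, neg_ne_zero.2 hu, c, rfl⟩, ?_⟩
  rw [← add_smul]
  congr 1
  ring

open scoped Pointwise in
theorem nsmul_columnMultiples_mono {r n : ℕ} {F : Type*} [Field F] (h2 : (2 : F) ≠ 0)
    (H : Matrix (Fin r) (Fin n) F) {m j : ℕ} (hm : 1 ≤ m) (hmj : m ≤ j) :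
    m • columnMultiples H ⊆ j • columnMultiples H := by
  induction j, hmj using Nat.le_induction with
  | base => exact subset_rfl
  | succ j hj ih =>
    refine ih.trans ?_
    obtain ⟨l, rfl⟩ : ∃ l, j = l + 1 := ⟨j - 1, by omega⟩
    rw [succ_nsmul _ (l + 1), succ_nsmul, add_assoc]
    exact Set.add_subset_add_left (columnMultiples_subset_add_self h2 H)

open scoped Pointwise in
theorem sum_smul_col_mem_nsmul {r n : ℕ} {F : Type*} [CommRing F] (H : Matrix (Fin r) (Fin n) F)
    (w : Fin n → F) (s : Finset (Fin n)) (hs : ∀ c ∈ s, w c ≠ 0) :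
    ∑ c ∈ s, w c • (fun i => H i c) ∈ s.card • columnMultiples H := by
  induction s using Finset.induction_on with
  | empty => simp
  | insert a s ha ih =>
    rw [Finset.sum_insert ha, Finset.card_insert_of_notMem ha, succ_nsmul']
    exact Set.add_mem_add ⟨w a, hs a (Finset.mem_insert_self a s), a, rfl⟩
      (ih fun c hc => hs c (Finset.mem_insert_of_mem hc))

open scoped Pointwise in
theorem mulVec_mem_nsmul_columnMultiples {r n : ℕ} {F : Type*} [CommRing F] [DecidableEq F]
    (H : Matrix (Fin r) (Fin n) F) (w : Fin n → F) :
    H.mulVec w ∈ hammingNorm w • columnMultiples H := by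
  have h := sum_smul_col_mem_nsmul H w {c | w c ≠ 0} (by simp)
  have heq : ∑ c ∈ ({c | w c ≠ 0} : Finset (Fin n)), w c • (fun i => H i c) = H.mulVec w := by
    rw [Finset.sum_filter_of_ne (fun c _ hc => mt (fun hw => by rw [hw, zero_smul]) hc)]
    ext i
    simp [Matrix.mulVec, dotProduct, mul_comm]
  rwa [heq] at h

theorem hammingNorm_add_le_add {ι F : Type*} [Fintype ι] [AddGroup F] [DecidableEq F] (v w : ι → F) :
    hammingNorm (v + w) ≤ hammingNorm v + hammingNorm w := by
  have h := hammingDist_triangle (v + w) v 0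
  rw [hammingDist_zero_right, hammingDist_zero_right, hammingDist_comm,
    hammingDist_eq_hammingNorm] at h
  simpa [add_comm] using h

open scoped Pointwise in
theorem exists_mulVec_of_mem_nsmul {r n : ℕ} {F : Type*} [CommRing F] [DecidableEq F]
    (H : Matrix (Fin r) (Fin n) F) {j : ℕ} {y : Fin r → F} (hy : y ∈ j • columnMultiples H) :
    ∃ w : Fin n → F, H.mulVec w = y ∧ hammingNorm w ≤ j := by
  induction j generalizing y with
  | zero =>
    rw [zero_nsmul, Set.mem_zero] at hy
    exact ⟨0, by simp [hy], by simp⟩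
  | succ j ih =>
    rw [succ_nsmul] at hy
    obtain ⟨a, ha, _, ⟨u, -, c, rfl⟩, rfl⟩ := Set.mem_add.1 hy
    obtain ⟨w, rfl, hw⟩ := ih ha
    refine ⟨w + Pi.single c u, ?_, (hammingNorm_add_le_add _ _).trans (add_le_add hw ?_)⟩
    · rw [Matrix.mulVec_add]
      congr 1
      ext i
      simp [mul_comm]
    · rw [hammingNorm, ← Finset.card_singleton c]
      refine Finset.card_le_card fun i hi => ?_
      by_contra hic
      simp_all [Pi.single_apply]

theorem sum_pow_val_dotProduct (q s : ℕ) [NeZero q] (ξ : ℂ) (hξ : IsPrimitiveRoot ξ q)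
    (z : Fin s → ZMod q) :
    ∑ ω : Fin s → ZMod q, ξ ^ (ω ⬝ᵥ z).val = if z = 0 then (q : ℂ) ^ s else 0 := by
  let e := AddChar.zmodChar q hξ.pow_eq_one
  let ψ : AddChar (Fin s → ZMod q) ℂ := e.compAddMonoidHom
    { toFun := fun ω => ω ⬝ᵥ z, map_zero' := zero_dotProduct z,
      map_add' := fun a b => add_dotProduct a b z }
  have hψ (ω) : ψ ω = ξ ^ (ω ⬝ᵥ z).val := rfl
  simp_rw [← hψ]
  split_ifs with hz
  · simp [hψ, hz]
  · apply AddChar.sum_eq_zero_of_ne_one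
    obtain ⟨i, hi⟩ := Function.ne_iff.1 hz
    refine AddChar.ne_one_iff.2 ⟨Pi.single i 1, fun h => hi ?_⟩
    rw [hψ, single_one_dotProduct, hξ.pow_eq_one_iff_dvd] at h
    exact (ZMod.val_eq_zero _).1 (Nat.eq_zero_of_dvd_of_lt h (ZMod.val_lt _))

theorem vcTransform_vcTransform_pow (q s : ℕ) [NeZero q] (ξ : ℂ) (hξ : IsPrimitiveRoot ξ q)
    (h : (Fin s → ZMod q) → ℂ) (j : ℕ) (y : Fin s → ZMod q) :
    vcTransform q s ξ ((vcTransform q s ξ h) ^ j) y =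
      ∑ p : Fin j → Fin s → ZMod q,
        (∏ i, h (p i)) * if y + ∑ i, p i = 0 then (q : ℂ) ^ s else 0 := by
  let e := AddChar.zmodChar q hξ.pow_eq_one
  have he (a : ZMod q) : ξ ^ a.val = e a := rfl
  have hsum (p : Fin j → Fin s → ZMod q) := sum_pow_val_dotProduct q s ξ hξ (y + ∑ i, p i)
  have hdef (g : (Fin s → ZMod q) → ℂ) (ω) :
      vcTransform q s ξ g ω = ∑ x, g x * e (ω ⬝ᵥ x) := rfl
  have hprod (a : Fin j → ZMod q) : e (∑ i, a i) = ∏ i, e (a i) :=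
    map_prod e.toMonoidHom (fun i => Multiplicative.ofAdd (a i)) Finset.univ
  simp_rw [← hsum, he, hdef, Pi.pow_apply, hdef, Fintype.sum_pow, Finset.sum_mul, Finset.mul_sum]
  rw [Finset.sum_comm]
  refine Finset.sum_congr rfl fun p _ => Finset.sum_congr rfl fun ω _ => ?_
  rw [Finset.prod_mul_distrib, dotProduct_add, dotProduct_sum, AddChar.map_add_eq_mul,
    dotProduct_comm y ω, hprod]
  ring

open scoped Pointwise in
theorem vcTransform_pow_colIndicator_ne_zero_iff (q s n : ℕ) [NeZero q] (ξ : ℂ)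
    (hξ : IsPrimitiveRoot ξ q) (H : Matrix (Fin s) (Fin n) (ZMod q)) (j : ℕ)
    (y : Fin s → ZMod q) :
    vcTransform q s ξ ((vcTransform q s ξ (colIndicator H)) ^ j) y ≠ 0 ↔
      y ∈ j • columnMultiples H := by
  have hq : (q : ℂ) ^ s ≠ 0 := pow_ne_zero _ (NeZero.ne _)
  have hind (x) : colIndicator H x = if x ∈ columnMultiples H then 1 else 0 := rfl
  have hterm (p : Fin j → Fin s → ZMod q) :
      ((∏ i, colIndicator H (p i)) * if y + ∑ i, p i = 0 then (q : ℂ) ^ s else 0) =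
        if (∀ i, p i ∈ columnMultiples H) ∧ ∑ i, p i = -y then (q : ℂ) ^ s else 0 := by
    simp_rw [hind, Finset.prod_ite_zero, add_comm y, add_eq_zero_iff_eq_neg]
    split_ifs <;> simp_all
  have hneg : y ∈ j • columnMultiples H ↔ -y ∈ j • columnMultiples H :=
    ⟨neg_mem_nsmul_columnMultiples, fun h => by simpa using neg_mem_nsmul_columnMultiples h⟩
  rw [vcTransform_vcTransform_pow q s ξ hξ, hneg, mem_nsmul_iff_exists_fin_sum]
  simp_rw [hterm]
  rw [← Finset.sum_filter, Finset.sum_const, nsmul_eq_mul, mul_ne_zero_iff, Nat.cast_ne_zero,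
    Finset.card_ne_zero]
  simp [hq, Finset.Nonempty]

/-- for an odd prime `q`, a parity check matrix `H` of a linear `[n,k]_q`
code, every `j ≥ 1` and every nonzero `y ∈ (ZMod q)^{n-k}`, the Vilenkin–Chrestenson
transform of `ĥ^j` at `y` is nonzero iff `y` is a linear combination of at most `j`
columns of `H` (i.e. `y = H·wᵀ` for some `w` of Hamming weight at most `j`). -/
theorem vcTransform_pow_ne_zero_iff_comb_of_columns
    (q : ℕ) [Fact q.Prime] (hodd : Odd q) (ξ : ℂ) (hξ : IsPrimitiveRoot ξ q)
    (n k : ℕ) (hkn : k ≤ n)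
    (H : Matrix (Fin (n - k)) (Fin n) (ZMod q))
    (hH : LinearIndependent (ZMod q) (fun i => H i))
    (j : ℕ) (hj : 1 ≤ j) (y : Fin (n - k) → ZMod q) (hy : y ≠ 0) :
    vcTransform q (n - k) ξ ((vcTransform q (n - k) ξ (colIndicator H)) ^ j) y ≠ 0 ↔
      ∃ w : Fin n → ZMod q, H.mulVec w = y ∧ hammingNorm w ≤ j := by
  rw [vcTransform_pow_colIndicator_ne_zero_iff q (n - k) n ξ hξ]
  refine ⟨exists_mulVec_of_mem_nsmul H, ?_⟩
  rintro ⟨w, rfl, hw⟩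
  have h2 : (2 : ZMod q) ≠ 0 := by
    have hq : q ≠ 2 := by
      rintro rfl
      exact absurd hodd (by decide)
    exact Ring.two_ne_zero (by rwa [ZMod.ringChar_zmod_n])
  have hw0 : 1 ≤ hammingNorm w := by
    rw [Nat.one_le_iff_ne_zero, hammingNorm_ne_zero_iff]
    rintro rfl
    exact hy (Matrix.mulVec_zero H)
  exact nsmul_columnMultiples_mono h2 H hw0 hw (mulVec_mem_nsmul_columnMultiples H w)
end
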